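/- Let 𝓗 be a well-structured preconditioner set in dimension d, let 𝒳 ⊆ ℝ^d be a nonempty bounded convex set with ‖𝒳‖_𝓗 > 0, and let x_1,…,x_{T+1}, g_t, M_t, H_t be AdaReg iterates with preconditioner set 𝓗, parameters ε > 0 and η = √2·‖𝒳‖_𝓗, convex set 𝒳, and differentiable convex losses L_1,…,L_T. Then for every x* ∈ 𝒳: Σ_{t=1}^T L_t(x_t) − Σ_{t=1}^T L_t(x*) ≤ 2√2·‖𝒳‖_𝓗·(|||g_{1:T}|||_𝓗 + d·√ε). -/

import Mathlib

open Matrix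

/-- A set of real `d × d` matrices closed under scalar multiplication, addition and
matrix multiplication, containing the identity. -/
def IsMatrixSubalgebra {d : ℕ} (K : Set (Matrix (Fin d) (Fin d) ℝ)) : Prop :=
  (∀ (c : ℝ), ∀ A ∈ K, c • A ∈ K) ∧ (∀ A ∈ K, ∀ B ∈ K, A + B ∈ K) ∧
    (∀ A ∈ K, ∀ B ∈ K, A * B ∈ K) ∧ (1 : Matrix (Fin d) (Fin d) ℝ) ∈ K

/-- A well-structured preconditioner set: `𝓗 = 𝒦 ∩ S₊^d` for a matrix subalgebra `𝒦`. -/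
def WellStructured {d : ℕ} (𝓗 : Set (Matrix (Fin d) (Fin d) ℝ)) : Prop :=
  ∃ K : Set (Matrix (Fin d) (Fin d) ℝ),
    IsMatrixSubalgebra K ∧ 𝓗 = K ∩ {M | M.PosSemidef}

/-- `⟨A,B⟩ := Tr(Aᵀ B)` for square real matrices. -/
noncomputable def minner {n : Type*} [Fintype n] (A B : Matrix n n ℝ) : ℝ := (Aᵀ * B).trace

/-- The `𝓗`-norm `‖x‖_𝓗 = sup{√(xᵀHx) : H ∈ 𝓗, Tr(H) ≤ 1}`. -/
noncomputable def hNorm {d : ℕ} (𝓗 : Set (Matrix (Fin d) (Fin d) ℝ)) (x : Fin d → ℝ) : ℝ :=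
  sSup {r | ∃ H ∈ 𝓗, H.trace ≤ 1 ∧ r = Real.sqrt (x ⬝ᵥ H.mulVec x)}

/-- The adaptive gradient norm `|||g_{1:T}|||_𝓗`. -/
noncomputable def adaNorm {d : ℕ} (𝓗 : Set (Matrix (Fin d) (Fin d) ℝ)) (T : ℕ)
    (g : ℕ → Fin d → ℝ) : ℝ :=
  sInf {r | ∃ H ∈ 𝓗, H.PosDef ∧ H.trace ≤ 1 ∧
    r = Real.sqrt (∑ s ∈ Finset.Icc 1 T, g s ⬝ᵥ H⁻¹.mulVec (g s))}

/-- The gradient of `f : ℝ^d → ℝ` at `x`, componentwise. -/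
noncomputable def grad {d : ℕ} (f : (Fin d → ℝ) → ℝ) (x : Fin d → ℝ) : Fin d → ℝ :=
  fun i => fderiv ℝ f x (Pi.single i 1)

/-- AdaReg iterates (Algorithm 1) with preconditioner set `𝓗`, parameters `ε, η`,
constraint set `𝒳` and differentiable convex losses `L 1, …, L T`. -/
def AdaReg {d : ℕ} (𝓗 : Set (Matrix (Fin d) (Fin d) ℝ)) (ε η : ℝ)
    (𝒳 : Set (Fin d → ℝ)) (T : ℕ) (L : ℕ → (Fin d → ℝ) → ℝ)
    (x g : ℕ → Fin d → ℝ) (M H : ℕ → Matrix (Fin d) (Fin d) ℝ) : Prop :=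
  x 1 ∈ 𝒳 ∧ M 0 = ε • (1 : Matrix (Fin d) (Fin d) ℝ) ∧
  ∀ t, 1 ≤ t → t ≤ T →
    Differentiable ℝ (L t) ∧ ConvexOn ℝ Set.univ (L t) ∧
    g t = grad (L t) (x t) ∧
    M t = M (t - 1) + Matrix.vecMulVec (g t) (g t) ∧
    H t ∈ 𝓗 ∧ (H t).PosDef ∧
    (∀ H' ∈ 𝓗, H'.PosDef →
      minner (M t) (H t)⁻¹ + η ^ 2 * (H t).trace ≤ minner (M t) H'⁻¹ + η ^ 2 * H'.trace) ∧
    x (t + 1) ∈ 𝒳 ∧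
    (∀ y ∈ 𝒳,
      (x (t + 1) - (x t - (H t)⁻¹.mulVec (g t))) ⬝ᵥ
          (H t).mulVec (x (t + 1) - (x t - (H t)⁻¹.mulVec (g t))) ≤
      (y - (x t - (H t)⁻¹.mulVec (g t))) ⬝ᵥ
          (H t).mulVec (y - (x t - (H t)⁻¹.mulVec (g t))))

section SymmetricMatrices

variable {n : Type*} [Fintype n]

lemma dotProduct_mulVec_symm {A : Matrix n n ℝ} (hA : A.IsHermitian) (u v : n → ℝ) :
    u ⬝ᵥ A *ᵥ v = v ⬝ᵥ A *ᵥ u := by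
  have hT : Aᵀ = A := by simpa using hA.eq
  rw [dotProduct_mulVec, ← mulVec_transpose, hT, dotProduct_comm]

lemma dotProduct_mulVec_add_self {A : Matrix n n ℝ} (hA : A.IsHermitian) (u v : n → ℝ) :
    (u + v) ⬝ᵥ A *ᵥ (u + v) = u ⬝ᵥ A *ᵥ u + 2 * (u ⬝ᵥ A *ᵥ v) + v ⬝ᵥ A *ᵥ v := by
  rw [mulVec_add, add_dotProduct, dotProduct_add, dotProduct_add, dotProduct_mulVec_symm hA v u]
  ring

lemma dotProduct_mulVec_sub_self {A : Matrix n n ℝ} (hA : A.IsHermitian) (u v : n → ℝ) :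
    (u - v) ⬝ᵥ A *ᵥ (u - v) = u ⬝ᵥ A *ᵥ u - 2 * (u ⬝ᵥ A *ᵥ v) + v ⬝ᵥ A *ᵥ v := by
  rw [mulVec_sub, sub_dotProduct, dotProduct_sub, dotProduct_sub, dotProduct_mulVec_symm hA v u]
  ring

lemma Matrix.PosSemidef.dotProduct_mulVec_self_nonneg {A : Matrix n n ℝ} (hA : A.PosSemidef)
    (v : n → ℝ) : 0 ≤ v ⬝ᵥ A *ᵥ v := by
  simpa using hA.dotProduct_mulVec_nonneg v

open scoped MatrixOrder in
lemma Matrix.PosSemidef.dotProduct_mulVec_le_trace_mul {A : Matrix n n ℝ} (hA : A.PosSemidef)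
    (v : n → ℝ) : v ⬝ᵥ A *ᵥ v ≤ A.trace * (v ⬝ᵥ v) := by
  classical
  obtain ⟨B, rfl⟩ := CStarAlgebra.nonneg_iff_eq_star_mul_self.mp hA.nonneg
  rw [star_eq_conjTranspose]
  have hquad : v ⬝ᵥ (Bᴴ * B) *ᵥ v = ∑ i, (∑ j, B i j * v j) ^ 2 := by
    rw [← mulVec_mulVec, dotProduct_mulVec, conjTranspose_eq_transpose_of_trivial,
      vecMul_transpose]
    simp [dotProduct, mulVec, sq]
  have htrace : (Bᴴ * B).trace = ∑ i, ∑ j, B i j ^ 2 := by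
    rw [Finset.sum_comm]
    simp [trace, mul_apply, sq]
  rw [hquad, htrace, Finset.sum_mul]
  refine Finset.sum_le_sum fun i _ => ?_
  simpa [dotProduct, sq] using Finset.sum_mul_sq_le_sq_mul_sq Finset.univ (B i) v

variable [DecidableEq n]

lemma Matrix.PosDef.mulVec_inv_mulVec {A : Matrix n n ℝ} (hA : A.PosDef) (v : n → ℝ) :
    A *ᵥ A⁻¹ *ᵥ v = v := by
  rw [mulVec_mulVec, mul_nonsing_inv _ ((isUnit_iff_isUnit_det _).mp hA.isUnit), one_mulVec]

lemma Matrix.PosDef.inv_smul_of_pos {A : Matrix n n ℝ} (hA : A.PosDef) {r : ℝ} (hr : 0 < r) :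
    (r • A)⁻¹ = r⁻¹ • A⁻¹ := by
  simpa [Units.smul_def] using
    inv_smul' A (Units.mk0 r hr.ne') ((isUnit_iff_isUnit_det _).mp hA.isUnit)

/-- Inversion is antitone on positive definite matrices. -/
lemma Matrix.PosDef.dotProduct_inv_add_mulVec_le {A B : Matrix n n ℝ} (hA : A.PosDef)
    (hB : B.PosSemidef) (v : n → ℝ) :
    v ⬝ᵥ (A + B)⁻¹ *ᵥ v ≤ v ⬝ᵥ A⁻¹ *ᵥ v := by
  have hAB := hA.add_posSemidef hB
  set u := A⁻¹ *ᵥ v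
  set w := (A + B)⁻¹ *ᵥ v
  have hu : A *ᵥ u = v := hA.mulVec_inv_mulVec v
  have hw : (A + B) *ᵥ w = v := hAB.mulVec_inv_mulVec v
  have hsq := hA.posSemidef.dotProduct_mulVec_self_nonneg (w - u)
  have hBw := hB.dotProduct_mulVec_self_nonneg w
  rw [dotProduct_mulVec_sub_self hA.isHermitian, hu] at hsq
  have hww : w ⬝ᵥ A *ᵥ w + w ⬝ᵥ B *ᵥ w = w ⬝ᵥ v := by
    rw [← dotProduct_add, ← add_mulVec, hw]
  rw [dotProduct_comm v u, dotProduct_comm v w]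
  linarith

lemma trace_eq_sum_dotProduct_mulVec_single (A : Matrix n n ℝ) :
    A.trace = ∑ i, Pi.single i 1 ⬝ᵥ A *ᵥ Pi.single i 1 := by
  simp [trace]

lemma Matrix.PosDef.trace_inv_add_le {A B : Matrix n n ℝ} (hA : A.PosDef)
    (hB : B.PosSemidef) : (A + B)⁻¹.trace ≤ A⁻¹.trace := by
  simp_rw [trace_eq_sum_dotProduct_mulVec_single]
  exact Finset.sum_le_sum fun i _ => hA.dotProduct_inv_add_mulVec_le hB _

lemma Matrix.IsHermitian.trace_mul_cfc {A : Matrix n n ℝ} (hA : A.IsHermitian)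
    (C : Matrix n n ℝ) (f : ℝ → ℝ) :
    (C * cfc f A).trace = ∑ i,
      ((hA.eigenvectorUnitary : Matrix n n ℝ)ᴴ * C * (hA.eigenvectorUnitary : Matrix n n ℝ)) i i
        * f (hA.eigenvalues i) := by
  rw [hA.cfc_eq, IsHermitian.cfc, Unitary.conjStarAlgAut_apply, ← mul_assoc, trace_mul_comm,
    ← mul_assoc, ← mul_assoc]
  simp [trace, mul_diagonal, star_eq_conjTranspose]

lemma Matrix.IsHermitian.cfc_mem {A : Matrix n n ℝ} (hA : A.IsHermitian)
    (K : Subalgebra ℝ (Matrix n n ℝ)) (hAK : A ∈ K) (f : ℝ → ℝ) : cfc f A ∈ K := by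
  classical
  have hfin := A.finite_real_spectrum
  set p := Lagrange.interpolate hfin.toFinset id f
  have hp : cfc f A = Polynomial.aeval A p := by
    rw [← cfc_polynomial p A hA]
    refine cfc_congr fun x hx => ?_
    exact (Lagrange.eval_interpolate_at_node f (Set.injOn_id _) (hfin.mem_toFinset.mpr hx)).symm
  rw [hp]
  exact Algebra.adjoin_le (Set.singleton_subset_iff.mpr hAK) (p.aeval_mem_adjoin_singleton ℝ A)

open scoped MatrixOrder in
/-- An operator monotonicity statement for the square root, relative to a subalgebra: only
the positive semidefinite test matrices of the subalgebra are needed. -/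
lemma posSemidef_sub_of_trace_sq_sub_sq_nonneg (K : Subalgebra ℝ (Matrix n n ℝ))
    {A B : Matrix n n ℝ} (hA : A.PosDef) (hB : B.PosDef) (hAK : A ∈ K) (hBK : B ∈ K)
    (h : ∀ N ∈ K, N.PosSemidef → 0 ≤ ((A * A - B * B) * N).trace) : (A - B).PosSemidef := by
  have hD : (A - B).IsHermitian := hA.isHermitian.sub hB.isHermitian
  set f : ℝ → ℝ := fun x => if x < 0 then 1 else 0
  have hcont (f : ℝ → ℝ) : ContinuousOn f (spectrum ℝ (A - B)) :=
    (A - B).finite_real_spectrum.continuousOn f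
  set N := cfc f (A - B)
  have hNpos : N.PosSemidef := by
    rw [← nonneg_iff_posSemidef]
    exact cfc_nonneg fun x _ => by dsimp only [f]; split_ifs <;> norm_num
  have hN := h N (hD.cfc_mem K (K.sub_mem hAK hBK) f) hNpos
  have hDN : (A - B) * N = cfc (fun x => x * f x) (A - B) := by
    rw [cfc_mul _ _ _ (hcont _) (hcont _), cfc_id' ℝ (A - B)]
  have hND : N * (A - B) = cfc (fun x => x * f x) (A - B) := by
    simp_rw [mul_comm _ (f _)]
    rw [cfc_mul _ _ _ (hcont _) (hcont _), cfc_id' ℝ (A - B)]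
  have hsplit : 2 * ((A * A - B * B) * N).trace
      = 2 * ((A + B) * cfc (fun x => x * f x) (A - B)).trace := by
    have hcomm : ((A - B) * (A + B) * N).trace = ((A + B) * (N * (A - B))).trace := by
      rw [mul_assoc, trace_mul_comm, mul_assoc]
    rw [two_mul, two_mul]
    conv_rhs => rw [← hDN]; arg 2; rw [hDN, ← hND, ← hcomm]
    rw [← trace_add, ← trace_add]
    congr 1
    noncomm_ring
  rw [hD.trace_mul_cfc (A + B)] at hsplit
  have hU : Function.Injective (hD.eigenvectorUnitary : Matrix n n ℝ).mulVec :=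
    mulVec_injective_of_isUnit (Unitary.isUnit_coe)
  have hdiag (i : n) := ((hA.add hB).conjTranspose_mul_mul_same hU).diag_pos (i := i)
  have hterm (i : n) : hD.eigenvalues i * f (hD.eigenvalues i) ≤ 0 := by
    dsimp only [f]; split_ifs <;> linarith
  rw [hD.posSemidef_iff_eigenvalues_nonneg]
  intro i
  by_contra! hi
  have hneg : hD.eigenvalues i * f (hD.eigenvalues i) < 0 := by
    have hi' : hD.eigenvalues i < 0 := hi
    simp [f, hi']
  have hlt := Finset.sum_neg' (s := Finset.univ)
    (fun j _ => mul_nonpos_of_nonneg_of_nonpos (hdiag j).le (hterm j))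
    ⟨i, Finset.mem_univ i, mul_neg_of_pos_of_neg (hdiag i) hneg⟩
  linarith

end SymmetricMatrices

section FirstOrder

variable {n : Type*} [Fintype n] [DecidableEq n]

attribute [local instance] Matrix.linftyOpNormedRing Matrix.linftyOpNormedAlgebra

lemma hasDerivAt_matrix_inv {A : ℝ → Matrix n n ℝ} {A' : Matrix n n ℝ} {s : ℝ}
    (hA : HasDerivAt A A' s) (hs : IsUnit (A s)) :
    HasDerivAt (fun r => (A r)⁻¹) (-((A s)⁻¹ * A' * (A s)⁻¹)) s := by
  obtain ⟨u, hu⟩ := hs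
  have hinv := hasFDerivAt_ringInverse (𝕜 := ℝ) u
  rw [hu] at hinv
  have h := hinv.comp_hasDerivAt s hA
  have hu' : (↑u⁻¹ : Matrix n n ℝ) = (A s)⁻¹ := by rw [← hu, coe_units_inv]
  simpa [Function.comp_def, nonsing_inv_eq_ringInverse, hu'] using! h

/-- First-order optimality condition for `H ↦ ⟨M, H⁻¹⟩ + c Tr H` over the positive definite
elements of a subalgebra: `c H²` and `M` have the same pairing with every symmetric element. -/
lemma minner_eq_of_isMinimizer (K : Subalgebra ℝ (Matrix n n ℝ)) {M H : Matrix n n ℝ} {c : ℝ}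
    (hHK : H ∈ K) (hH : H.PosDef)
    (hmin : ∀ H' ∈ K, H'.PosDef →
      minner M H⁻¹ + c * H.trace ≤ minner M H'⁻¹ + c * H'.trace)
    {D : Matrix n n ℝ} (hDK : D ∈ K) (hD : D.IsHermitian) :
    minner M D = c * (H * H * D).trace := by
  set P : ℝ → Matrix n n ℝ := fun s => 1 + s • (D * H)
  set Q : ℝ → Matrix n n ℝ := fun s =>
    H + (s • ((2 : ℝ) • (H * D * H)) + s ^ 2 • (H * D * H * D * H))
  have hPQ (s : ℝ) : (P s)ᴴ * H * P s = Q s := by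
    simp only [P, Q, conjTranspose_add, conjTranspose_one, conjTranspose_smul, conjTranspose_mul,
      hD.eq, hH.isHermitian.eq, star_trivial, two_smul, sq]
    simp only [mul_add, add_mul, mul_one, one_mul, smul_mul_assoc, mul_smul_comm, mul_assoc,
      smul_add, smul_smul]
    abel
  have hQ0 : Q 0 = H := by simp [Q]
  have hQK (s : ℝ) : Q s ∈ K := by
    have hHDH := K.mul_mem (K.mul_mem hHK hDK) hHK
    exact K.add_mem hHK (K.add_mem (K.smul_mem (K.smul_mem hHDH _) _)
      (K.smul_mem (K.mul_mem (K.mul_mem hHDH hDK) hHK) _))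
  have hQpos : ∀ᶠ s in nhds (0 : ℝ), (Q s).PosDef := by
    have hcont : Continuous P := by fun_prop
    have hunit : P 0 ∈ {A : Matrix n n ℝ | IsUnit A} := by simp [P]
    filter_upwards [hcont.continuousAt.preimage_mem_nhds (Units.isOpen.mem_nhds hunit)] with s hs
    rw [← hPQ]
    exact hH.conjTranspose_mul_mul_same (mulVec_injective_of_isUnit hs)
  have hQ' : HasDerivAt Q ((2 : ℝ) • (H * D * H)) 0 := by
    have h := (((hasDerivAt_id (0 : ℝ)).smul_const ((2 : ℝ) • (H * D * H))).add
      ((hasDerivAt_pow 2 (0 : ℝ)).smul_const (H * D * H * D * H))).const_add H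
    exact h.congr_deriv (by simp)
  have hdet : IsUnit H.det := (isUnit_iff_isUnit_det _).mp hH.isUnit
  have hQinv : HasDerivAt (fun s => (Q s)⁻¹) (-((2 : ℝ) • D)) 0 := by
    have h := hasDerivAt_matrix_inv hQ' (by rw [hQ0]; exact hH.isUnit)
    rw [hQ0] at h
    convert h using 2
    rw [mul_smul_comm, smul_mul_assoc, mul_assoc H D H, nonsing_inv_mul_cancel_left _ _ hdet,
      mul_nonsing_inv_cancel_right _ _ hdet]
  set ℓ : Matrix n n ℝ →L[ℝ] ℝ := LinearMap.toContinuousLinearMap (traceLinearMap n ℝ ℝ)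
  set m : Matrix n n ℝ →L[ℝ] ℝ := ℓ.comp (ContinuousLinearMap.mul ℝ (Matrix n n ℝ) Mᵀ)
  have hφ : HasDerivAt (fun s => minner M (Q s)⁻¹ + c * (Q s).trace)
      (m (-((2 : ℝ) • D)) + c * ℓ ((2 : ℝ) • (H * D * H))) 0 :=
    (m.hasFDerivAt.comp_hasDerivAt 0 hQinv).add
      ((ℓ.hasFDerivAt.comp_hasDerivAt 0 hQ').const_mul c)
  have hloc : IsLocalMin (fun s => minner M (Q s)⁻¹ + c * (Q s).trace) 0 := by
    filter_upwards [hQpos] with s hs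
    simpa only [hQ0] using hmin (Q s) (hQK s) hs
  have hzero := hloc.hasDerivAt_eq_zero hφ
  have hm : m (-((2 : ℝ) • D)) = -(2 * minner M D) := by
    rw [map_neg, map_smul]; rfl
  have hℓ : ℓ ((2 : ℝ) • (H * D * H)) = 2 * (H * H * D).trace := by
    rw [map_smul, mul_assoc H H D, trace_mul_comm H (H * D)]; rfl
  rw [hm, hℓ] at hzero
  linarith

end FirstOrder

section WellStructured

variable {d : ℕ}

/-- The `ℝ`-subalgebra carried by a set satisfying `IsMatrixSubalgebra`. -/
def IsMatrixSubalgebra.toSubalgebra {K : Set (Matrix (Fin d) (Fin d) ℝ)}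
    (hK : IsMatrixSubalgebra K) : Subalgebra ℝ (Matrix (Fin d) (Fin d) ℝ) where
  carrier := K
  mul_mem' {A B} hA hB := hK.2.2.1 A hA B hB
  add_mem' {A B} hA hB := hK.2.1 A hA B hB
  algebraMap_mem' r := by
    rw [Algebra.algebraMap_eq_smul_one]
    exact hK.1 r 1 hK.2.2.2

lemma WellStructured.exists_subalgebra {𝓗 : Set (Matrix (Fin d) (Fin d) ℝ)}
    (h : WellStructured 𝓗) :
    ∃ K : Subalgebra ℝ (Matrix (Fin d) (Fin d) ℝ), ∀ A, A ∈ 𝓗 ↔ A ∈ K ∧ A.PosSemidef := by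
  obtain ⟨K, hK, rfl⟩ := h
  exact ⟨hK.toSubalgebra, fun A => Iff.rfl⟩

lemma minner_vecMulVec_self (v : Fin d → ℝ) (A : Matrix (Fin d) (Fin d) ℝ) :
    minner (vecMulVec v v) A = v ⬝ᵥ A *ᵥ v := by
  rw [minner, transpose_vecMulVec, vecMulVec_mul, trace_vecMulVec, dotProduct_mulVec,
    dotProduct_comm]

lemma minner_add_left (A B C : Matrix (Fin d) (Fin d) ℝ) :
    minner (A + B) C = minner A C + minner B C := by
  simp [minner, add_mul]

/-- The minimizers of `H ↦ ⟨M, H⁻¹⟩ + c Tr H` are monotone under rank-one updates of `M`. -/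
lemma posSemidef_sub_of_isMinimizer (K : Subalgebra ℝ (Matrix (Fin d) (Fin d) ℝ))
    {M A B : Matrix (Fin d) (Fin d) ℝ} {c : ℝ} (hc : 0 < c) (v : Fin d → ℝ)
    (hAK : A ∈ K) (hA : A.PosDef) (hBK : B ∈ K) (hB : B.PosDef)
    (hminA : ∀ H ∈ K, H.PosDef → minner (M + vecMulVec v v) A⁻¹ + c * A.trace ≤
      minner (M + vecMulVec v v) H⁻¹ + c * H.trace)
    (hminB : ∀ H ∈ K, H.PosDef → minner M B⁻¹ + c * B.trace ≤ minner M H⁻¹ + c * H.trace) :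
    (A - B).PosSemidef := by
  refine posSemidef_sub_of_trace_sq_sub_sq_nonneg K hA hB hAK hBK fun N hNK hN => ?_
  have h₁ := minner_eq_of_isMinimizer K hAK hA hminA hNK hN.isHermitian
  have h₂ := minner_eq_of_isMinimizer K hBK hB hminB hNK hN.isHermitian
  rw [minner_add_left, minner_vecMulVec_self, h₂] at h₁
  have hv := hN.dotProduct_mulVec_self_nonneg v
  rw [sub_mul, trace_sub]
  refine nonneg_of_mul_nonneg_right (a := c) ?_ hc
  linarith

/-- At a minimizer of `H ↦ ⟨M, H⁻¹⟩ + c Tr H` the trace term is dominated by the pairing. -/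
lemma mul_trace_le_minner_inv_of_isMinimizer (K : Subalgebra ℝ (Matrix (Fin d) (Fin d) ℝ))
    {M A : Matrix (Fin d) (Fin d) ℝ} {c : ℝ} (hAK : A ∈ K) (hA : A.PosDef)
    (hmin : ∀ H ∈ K, H.PosDef → minner M A⁻¹ + c * A.trace ≤ minner M H⁻¹ + c * H.trace) :
    c * A.trace ≤ minner M A⁻¹ := by
  have hscale (r : ℝ) (hr₀ : 0 < r) (hr₁ : r < 1) : r * (c * A.trace) ≤ minner M A⁻¹ := by
    have h := hmin (r • A) (K.smul_mem hAK r) (hA.smul hr₀)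
    rw [hA.inv_smul_of_pos hr₀, trace_smul, smul_eq_mul] at h
    have hm : minner M (r⁻¹ • A⁻¹) = r⁻¹ * minner M A⁻¹ := by simp [minner]
    rw [hm] at h
    have h' := mul_le_mul_of_nonneg_left h hr₀.le
    rw [mul_add, mul_add, mul_inv_cancel_left₀ hr₀.ne'] at h'
    nlinarith
  have hlim : Filter.Tendsto (fun r : ℝ => r * (c * A.trace)) (nhdsWithin 1 (Set.Iio 1))
      (nhds (1 * (c * A.trace))) :=
    (Continuous.tendsto (by fun_prop) 1).mono_left nhdsWithin_le_nhds
  rw [one_mul] at hlim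
  refine le_of_tendsto hlim ?_
  filter_upwards [Ioo_mem_nhdsLT (zero_lt_one' ℝ)] with r hr
  exact hscale r hr.1 hr.2

end WellStructured

section Regret

variable {d : ℕ}

lemma grad_dotProduct (f : (Fin d → ℝ) → ℝ) (x v : Fin d → ℝ) :
    grad f x ⬝ᵥ v = fderiv ℝ f x v := by
  conv_rhs => rw [pi_eq_sum_univ' v, map_sum]
  exact Finset.sum_congr rfl fun i _ => by simp [grad, mul_comm]

lemma ConvexOn.sub_le_grad_dotProduct {f : (Fin d → ℝ) → ℝ} (hf : ConvexOn ℝ Set.univ f)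
    (hd : Differentiable ℝ f) (x y : Fin d → ℝ) : f x - f y ≤ grad f x ⬝ᵥ (x - y) := by
  have hline : ConvexOn ℝ Set.univ (f ∘ AffineMap.lineMap (k := ℝ) x y) := by
    simpa using hf.comp_affineMap (AffineMap.lineMap x y)
  have hderiv : HasDerivAt (f ∘ AffineMap.lineMap (k := ℝ) x y) (fderiv ℝ f x (y - x)) 0 := by
    have hfx : HasFDerivAt f (fderiv ℝ f x) (AffineMap.lineMap x y (0 : ℝ)) := by
      simpa using (hd x).hasFDerivAt
    exact hfx.comp_hasDerivAt 0 AffineMap.hasDerivAt_lineMap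
  have h := hline.le_slope_of_hasDerivAt (Set.mem_univ 0) (Set.mem_univ 1) zero_lt_one hderiv
  simp only [slope_def_field, Function.comp_apply, AffineMap.lineMap_apply_one,
    AffineMap.lineMap_apply_zero, sub_zero, div_one] at h
  rw [grad_dotProduct, ← neg_sub y x, map_neg]
  linarith

/-- Projections onto a convex set in the norm of a positive semidefinite matrix do not increase
the distance to points of the set. -/
lemma dotProduct_mulVec_sub_le_of_isProjection {A : Matrix (Fin d) (Fin d) ℝ}
    (hA : A.PosSemidef) {S : Set (Fin d → ℝ)} (hS : Convex ℝ S) {p z y : Fin d → ℝ}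
    (hp : p ∈ S) (hy : y ∈ S)
    (hmin : ∀ w ∈ S, (p - z) ⬝ᵥ A *ᵥ (p - z) ≤ (w - z) ⬝ᵥ A *ᵥ (w - z)) :
    (p - y) ⬝ᵥ A *ᵥ (p - y) ≤ (z - y) ⬝ᵥ A *ᵥ (z - y) := by
  have hH := hA.isHermitian
  set b := (p - z) ⬝ᵥ A *ᵥ (y - p)
  set q := (y - p) ⬝ᵥ A *ᵥ (y - p)
  have hstep (s : ℝ) (hs₀ : 0 < s) (hs₁ : s < 1) : 0 ≤ 2 * b + s * q := by
    have hw : p + s • (y - p) ∈ S := hS.add_smul_sub_mem hp hy ⟨hs₀.le, hs₁.le⟩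
    have h := hmin _ hw
    rw [add_sub_right_comm, dotProduct_mulVec_add_self hH, mulVec_smul, dotProduct_smul,
      smul_dotProduct, dotProduct_smul] at h
    simp only [smul_eq_mul] at h
    refine nonneg_of_mul_nonneg_right (a := s) ?_ hs₀
    linarith
  have hlim : Filter.Tendsto (fun s : ℝ => 2 * b + s * q) (nhdsWithin 0 (Set.Ioi 0))
      (nhds (2 * b + 0 * q)) :=
    (Continuous.tendsto (by fun_prop) 0).mono_left nhdsWithin_le_nhds
  have hb : 0 ≤ 2 * b + 0 * q := by
    refine ge_of_tendsto hlim ?_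
    filter_upwards [Ioo_mem_nhdsGT (zero_lt_one' ℝ)] with s hs
    exact hstep s hs.1 hs.2
  have hz := hA.dotProduct_mulVec_self_nonneg (p - z)
  have hsum := dotProduct_mulVec_add_self hH (p - z) (y - p)
  have hq : (p - y) ⬝ᵥ A *ᵥ (p - y) = q := by
    rw [← neg_sub y p, mulVec_neg, neg_dotProduct_neg]
  have hzy : (z - y) ⬝ᵥ A *ᵥ (z - y) = (p - z + (y - p)) ⬝ᵥ A *ᵥ (p - z + (y - p)) := by
    rw [← neg_sub y z, mulVec_neg, neg_dotProduct_neg, ← sub_add_sub_cancel y p z,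
      add_comm (y - p)]
  rw [hq, hzy, hsum]
  linarith

/-- One step of preconditioned projected gradient descent. -/
lemma two_mul_dotProduct_le_of_isProjection {A : Matrix (Fin d) (Fin d) ℝ} (hA : A.PosDef)
    {S : Set (Fin d → ℝ)} (hS : Convex ℝ S) {p x v y : Fin d → ℝ} (hp : p ∈ S) (hy : y ∈ S)
    (hmin : ∀ w ∈ S, (p - (x - A⁻¹ *ᵥ v)) ⬝ᵥ A *ᵥ (p - (x - A⁻¹ *ᵥ v)) ≤
      (w - (x - A⁻¹ *ᵥ v)) ⬝ᵥ A *ᵥ (w - (x - A⁻¹ *ᵥ v))) :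
    2 * (v ⬝ᵥ (x - y)) ≤
      v ⬝ᵥ A⁻¹ *ᵥ v + (x - y) ⬝ᵥ A *ᵥ (x - y) - (p - y) ⬝ᵥ A *ᵥ (p - y) := by
  have h := dotProduct_mulVec_sub_le_of_isProjection hA.posSemidef hS hp hy hmin
  rw [sub_right_comm, dotProduct_mulVec_sub_self hA.isHermitian (x - y),
    hA.mulVec_inv_mulVec] at h
  rw [dotProduct_comm v (x - y), dotProduct_comm v (A⁻¹ *ᵥ v)]
  linarith

lemma hNorm_bddAbove (K : Subalgebra ℝ (Matrix (Fin d) (Fin d) ℝ))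
    {𝓗 : Set (Matrix (Fin d) (Fin d) ℝ)} (h𝓗 : ∀ A, A ∈ 𝓗 ↔ A ∈ K ∧ A.PosSemidef)
    (x : Fin d → ℝ) :
    BddAbove {r | ∃ H ∈ 𝓗, H.trace ≤ 1 ∧ r = Real.sqrt (x ⬝ᵥ H.mulVec x)} := by
  refine ⟨Real.sqrt (x ⬝ᵥ x), ?_⟩
  rintro _ ⟨H, hH, htr, rfl⟩
  refine Real.sqrt_le_sqrt ((((h𝓗 H).mp hH).2.dotProduct_mulVec_le_trace_mul x).trans ?_)
  exact mul_le_of_le_one_left (by simpa using dotProduct_star_self_nonneg x) htr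

lemma dotProduct_mulVec_le_sq_hNorm_mul_trace (K : Subalgebra ℝ (Matrix (Fin d) (Fin d) ℝ))
    {𝓗 : Set (Matrix (Fin d) (Fin d) ℝ)} (h𝓗 : ∀ A, A ∈ 𝓗 ↔ A ∈ K ∧ A.PosSemidef)
    (x : Fin d → ℝ) {A : Matrix (Fin d) (Fin d) ℝ} (hA : A ∈ 𝓗) :
    x ⬝ᵥ A *ᵥ x ≤ hNorm 𝓗 x ^ 2 * A.trace := by
  obtain ⟨hAK, hApos⟩ := (h𝓗 A).mp hA
  rcases hApos.trace_nonneg.eq_or_lt with htr | htr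
  · have h := hApos.dotProduct_mulVec_le_trace_mul x
    rw [← htr, zero_mul] at h
    rwa [← htr, mul_zero]
  · have hmem : A.trace⁻¹ • A ∈ 𝓗 :=
      (h𝓗 _).mpr ⟨K.smul_mem hAK _, hApos.smul (inv_nonneg.mpr htr.le)⟩
    have hle : Real.sqrt (x ⬝ᵥ (A.trace⁻¹ • A) *ᵥ x) ≤ hNorm 𝓗 x :=
      le_csSup (hNorm_bddAbove K h𝓗 x)
        ⟨_, hmem, by rw [trace_smul, smul_eq_mul, inv_mul_cancel₀ htr.ne'], rfl⟩
    have hsq := (Real.sqrt_le_left ((Real.sqrt_nonneg _).trans hle)).mp hle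
    rw [smul_mulVec, dotProduct_smul, smul_eq_mul] at hsq
    rwa [← div_le_iff₀ htr, div_eq_inv_mul]

lemma hNorm_nonneg (𝓗 : Set (Matrix (Fin d) (Fin d) ℝ)) (x : Fin d → ℝ) : 0 ≤ hNorm 𝓗 x := by
  refine Real.sSup_nonneg ?_
  rintro _ ⟨H, -, -, rfl⟩
  exact Real.sqrt_nonneg _

lemma sub_dotProduct_mulVec_sub_le (K : Subalgebra ℝ (Matrix (Fin d) (Fin d) ℝ))
    {𝓗 : Set (Matrix (Fin d) (Fin d) ℝ)} (h𝓗 : ∀ A, A ∈ 𝓗 ↔ A ∈ K ∧ A.PosSemidef)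
    {x y : Fin d → ℝ} {R : ℝ} (hx : hNorm 𝓗 x ≤ R) (hy : hNorm 𝓗 y ≤ R)
    {A : Matrix (Fin d) (Fin d) ℝ} (hA : A ∈ 𝓗) :
    (x - y) ⬝ᵥ A *ᵥ (x - y) ≤ 4 * R ^ 2 * A.trace := by
  have hApos := ((h𝓗 A).mp hA).2
  have hbound {z : Fin d → ℝ} (hz : hNorm 𝓗 z ≤ R) : z ⬝ᵥ A *ᵥ z ≤ R ^ 2 * A.trace :=
    (dotProduct_mulVec_le_sq_hNorm_mul_trace K h𝓗 z hA).trans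
      (mul_le_mul_of_nonneg_right (pow_le_pow_left₀ (hNorm_nonneg 𝓗 z) hz 2) hApos.trace_nonneg)
  have hadd := hApos.dotProduct_mulVec_self_nonneg (x + y)
  rw [dotProduct_mulVec_add_self hApos.isHermitian] at hadd
  rw [dotProduct_mulVec_sub_self hApos.isHermitian]
  linarith [hbound hx, hbound hy]

/-- The optimal value of the regularized problem is controlled by the adaptive gradient norm. -/
lemma isMinimizer_le_adaNorm (K : Subalgebra ℝ (Matrix (Fin d) (Fin d) ℝ))
    {𝓗 : Set (Matrix (Fin d) (Fin d) ℝ)} (h𝓗 : ∀ A, A ∈ 𝓗 ↔ A ∈ K ∧ A.PosSemidef)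
    {ε η : ℝ} (hε : 0 < ε) (hη : 0 < η) (T : ℕ) (g : ℕ → Fin d → ℝ) {m : ℝ}
    (hmin : ∀ H ∈ K, H.PosDef → m ≤ minner (ε • (1 : Matrix (Fin d) (Fin d) ℝ) +
      ∑ t ∈ Finset.Icc 1 T, vecMulVec (g t) (g t)) H⁻¹ + η ^ 2 * H.trace) :
    m ≤ 2 * η * (adaNorm 𝓗 T g + d * Real.sqrt ε) := by
  have hone : (1 : Matrix (Fin d) (Fin d) ℝ).PosDef := PosDef.one
  have hsε := Real.sqrt_pos.mpr hε
  have key : ∀ H ∈ 𝓗, H.PosDef → H.trace ≤ 1 → ∀ r,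
      Real.sqrt (∑ s ∈ Finset.Icc 1 T, g s ⬝ᵥ H⁻¹ *ᵥ g s) < r →
        m ≤ 2 * η * (r + d * Real.sqrt ε) := by
    intro H hH hHpos htr r hr
    set Q := ∑ s ∈ Finset.Icc 1 T, g s ⬝ᵥ H⁻¹ *ᵥ g s
    have hr₀ : 0 < r := (Real.sqrt_nonneg _).trans_lt hr
    have hQ : Q ≤ r ^ 2 := ((Real.sqrt_lt' hr₀).mp hr).le
    set a := r / η
    set b := Real.sqrt ε / η
    have ha : 0 < a := div_pos hr₀ hη
    have hb : 0 < b := div_pos hsε hη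
    have haH := hHpos.smul ha
    have hbI := hone.smul hb
    have h := hmin (a • H + b • 1) (K.add_mem (K.smul_mem ((h𝓗 H).mp hH).1 a)
      (K.smul_mem K.one_mem b)) (haH.add hbI)
    have hgrad : ∑ s ∈ Finset.Icc 1 T, g s ⬝ᵥ (a • H + b • 1)⁻¹ *ᵥ g s ≤ a⁻¹ * Q := by
      rw [Finset.mul_sum]
      refine Finset.sum_le_sum fun s _ => ?_
      refine (haH.dotProduct_inv_add_mulVec_le hbI.posSemidef (g s)).trans_eq ?_
      rw [hHpos.inv_smul_of_pos ha, smul_mulVec, dotProduct_smul, smul_eq_mul]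
    have htrace : (a • H + b • (1 : Matrix (Fin d) (Fin d) ℝ))⁻¹.trace ≤ b⁻¹ * d := by
      rw [add_comm]
      refine (hbI.trace_inv_add_le haH.posSemidef).trans_eq ?_
      rw [hone.inv_smul_of_pos hb]
      simp
    have hsplit : minner (ε • (1 : Matrix (Fin d) (Fin d) ℝ) +
        ∑ t ∈ Finset.Icc 1 T, vecMulVec (g t) (g t)) (a • H + b • 1)⁻¹
        = ε * (a • H + b • (1 : Matrix (Fin d) (Fin d) ℝ))⁻¹.trace
          + ∑ s ∈ Finset.Icc 1 T, g s ⬝ᵥ (a • H + b • 1)⁻¹ *ᵥ g s := by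
      rw [minner_add_left]
      congr 1
      · simp [minner]
      · simp_rw [← minner_vecMulVec_self]
        simp [minner, transpose_sum, Finset.sum_mul, trace_sum]
    rw [hsplit, trace_add, trace_smul, trace_smul, trace_one, Fintype.card_fin, smul_eq_mul,
      smul_eq_mul] at h
    have h₁ : a⁻¹ * Q ≤ η * r :=
      (mul_le_mul_of_nonneg_left hQ (inv_nonneg.mpr ha.le)).trans_eq (by simp only [a]; field_simp)
    have h₂ : ε * (b⁻¹ * d) = η * (d * Real.sqrt ε) := by
      nth_rw 1 [← Real.sq_sqrt hε.le]
      simp only [b]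
      field_simp
    have h₃ : η ^ 2 * (a * H.trace + b * d) ≤ η * r + η * (d * Real.sqrt ε) := by
      have hle : a * H.trace ≤ a := mul_le_of_le_one_right ha.le htr
      calc η ^ 2 * (a * H.trace + b * d) ≤ η ^ 2 * (a + b * d) := by gcongr
        _ = η * r + η * (d * Real.sqrt ε) := by simp only [a, b]; field_simp
    have h₄ := mul_le_mul_of_nonneg_left htrace hε.le
    linarith
  have hne : {r | ∃ H ∈ 𝓗, H.PosDef ∧ H.trace ≤ 1 ∧
      r = Real.sqrt (∑ s ∈ Finset.Icc 1 T, g s ⬝ᵥ H⁻¹.mulVec (g s))}.Nonempty := by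
    have hd : (0 : ℝ) < ((d : ℝ) + 1)⁻¹ := by positivity
    refine ⟨_, ((d : ℝ) + 1)⁻¹ • 1, (h𝓗 _).mpr ⟨K.smul_mem K.one_mem _, (hone.smul hd).posSemidef⟩,
      hone.smul hd, ?_, rfl⟩
    rw [trace_smul, trace_one, Fintype.card_fin, smul_eq_mul, inv_mul_le_one₀ (by positivity)]
    linarith
  have hlt (r : ℝ) (hr : adaNorm 𝓗 T g < r) : m ≤ 2 * η * (r + d * Real.sqrt ε) := by
    obtain ⟨_, ⟨H, hH, hHpos, htr, rfl⟩, hr'⟩ := exists_lt_of_csInf_lt hne hr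
    exact key H hH hHpos htr r hr'
  have hlim : Filter.Tendsto (fun r : ℝ => 2 * η * (r + d * Real.sqrt ε))
      (nhdsWithin (adaNorm 𝓗 T g) (Set.Ioi (adaNorm 𝓗 T g)))
      (nhds (2 * η * (adaNorm 𝓗 T g + d * Real.sqrt ε))) :=
    (Continuous.tendsto (by fun_prop) _).mono_left nhdsWithin_le_nhds
  refine ge_of_tendsto hlim ?_
  filter_upwards [self_mem_nhdsWithin] with r hr
  exact hlt r hr

end Regret

theorem stmt_8 {d : ℕ} (𝓗 : Set (Matrix (Fin d) (Fin d) ℝ)) (h𝓗 : WellStructured 𝓗)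
    (𝒳 : Set (Fin d → ℝ)) (h𝒳conv : Convex ℝ 𝒳) (h𝒳ne : 𝒳.Nonempty)
    (h𝒳bdd : Bornology.IsBounded 𝒳)
    (norm𝒳 : ℝ) (hnorm𝒳 : norm𝒳 = sSup {r | ∃ x ∈ 𝒳, r = hNorm 𝓗 x})
    (hpos : 0 < norm𝒳)
    (ε : ℝ) (hε : 0 < ε)
    (T : ℕ) (hT : 1 ≤ T) (L : ℕ → (Fin d → ℝ) → ℝ)
    (x g : ℕ → Fin d → ℝ) (M H : ℕ → Matrix (Fin d) (Fin d) ℝ)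
    (hiter : AdaReg 𝓗 ε (Real.sqrt 2 * norm𝒳) 𝒳 T L x g M H) :
    ∀ xstar ∈ 𝒳,
      ∑ t ∈ Finset.Icc 1 T, L t (x t) - ∑ t ∈ Finset.Icc 1 T, L t xstar ≤
        2 * Real.sqrt 2 * norm𝒳 * (adaNorm 𝓗 T g + d * Real.sqrt ε) := by
  intro y hy
  obtain ⟨K, hK⟩ := h𝓗.exists_subalgebra
  obtain ⟨hx₁, hM₀, hstep⟩ := hiter
  have hη : 0 < Real.sqrt 2 * norm𝒳 := by positivity
  set η := Real.sqrt 2 * norm𝒳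
  have hηsq : η ^ 2 = 2 * norm𝒳 ^ 2 := by rw [mul_pow, Real.sq_sqrt zero_le_two]
  have hbdd : BddAbove {r | ∃ x ∈ 𝒳, r = hNorm 𝓗 x} := by
    by_contra hunbdd
    rw [hnorm𝒳, Real.sSup_of_not_bddAbove hunbdd] at hpos
    exact hpos.false
  have hnorm (z : Fin d → ℝ) (hz : z ∈ 𝒳) : hNorm 𝓗 z ≤ norm𝒳 := by
    rw [hnorm𝒳]
    exact le_csSup hbdd ⟨z, hz, rfl⟩
  have hxmem (t : ℕ) (ht : 1 ≤ t) (htT : t ≤ T) : x t ∈ 𝒳 := by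
    obtain rfl | hlt := ht.eq_or_lt
    · exact hx₁
    · obtain ⟨-, -, -, -, -, -, -, hx, -⟩ := hstep (t - 1) (by omega) (by omega)
      rwa [Nat.sub_add_cancel ht] at hx
  have hmin (t : ℕ) (ht : 1 ≤ t) (htT : t ≤ T) : ∀ H' ∈ K, H'.PosDef →
      minner (M t) (H t)⁻¹ + η ^ 2 * (H t).trace ≤ minner (M t) H'⁻¹ + η ^ 2 * H'.trace := by
    obtain ⟨-, -, -, -, -, -, hopt, -, -⟩ := hstep t ht htT
    exact fun H' hH'K hH' => hopt H' ((hK H').mpr ⟨hH'K, hH'.posSemidef⟩) hH'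
  have hMsum (t : ℕ) (htT : t ≤ T) :
      M t = ε • 1 + ∑ s ∈ Finset.Icc 1 t, vecMulVec (g s) (g s) := by
    induction t with
    | zero => simpa using hM₀
    | succ k ih =>
      obtain ⟨-, -, -, hM, -⟩ := hstep (k + 1) (by omega) htT
      rw [hM, Nat.add_sub_cancel, ih (by omega), Finset.sum_Icc_succ_top (by omega), add_assoc]
  have hregret (t : ℕ) (ht : 1 ≤ t) (htT : t ≤ T) :
      2 * ∑ s ∈ Finset.Icc 1 t, g s ⬝ᵥ (x s - y) ≤
        minner (M t) (H t)⁻¹ + η ^ 2 * (H t).trace + 4 * norm𝒳 ^ 2 * (H t).trace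
          - (x (t + 1) - y) ⬝ᵥ H t *ᵥ (x (t + 1) - y) := by
    induction t, ht using Nat.le_induction with
    | base =>
      obtain ⟨-, -, -, hM, hHmem, hHpos, -, hx, hproj⟩ := hstep 1 le_rfl htT
      have hdesc := two_mul_dotProduct_le_of_isProjection hHpos h𝒳conv hx hy hproj
      have hdiam := sub_dotProduct_mulVec_sub_le K hK (hnorm _ hx₁) (hnorm _ hy) hHmem
      have hM₀nonneg : 0 ≤ minner (M 0) (H 1)⁻¹ := by
        have htr := hHpos.inv.posSemidef.trace_nonneg
        simpa [hM₀, minner] using mul_nonneg hε.le htr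
      have htr := mul_nonneg (sq_nonneg η) hHpos.posSemidef.trace_nonneg
      rw [hM, minner_add_left, minner_vecMulVec_self, Finset.Icc_self, Finset.sum_singleton]
      linarith
    | succ k hk ih =>
      obtain ⟨-, -, -, hM, hHmem, hHpos, -, hx, hproj⟩ := hstep (k + 1) (by omega) htT
      obtain ⟨-, -, -, -, hHmem', hHpos', -⟩ := hstep k hk (by omega)
      rw [Nat.add_sub_cancel] at hM
      have hHK := ((hK _).mp hHmem).1
      have hHK' := ((hK _).mp hHmem').1
      have hdesc := two_mul_dotProduct_le_of_isProjection hHpos h𝒳conv hx hy hproj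
      have hmono : (H (k + 1) - H k).PosSemidef :=
        posSemidef_sub_of_isMinimizer K (pow_pos hη 2) (g (k + 1)) hHK hHpos hHK' hHpos'
          (hM ▸ hmin (k + 1) (by omega) htT) (hmin k hk (by omega))
      have hdiam := sub_dotProduct_mulVec_sub_le K hK
        (hnorm _ (hxmem (k + 1) (by omega) htT)) (hnorm _ hy)
        ((hK _).mpr ⟨K.sub_mem hHK hHK', hmono⟩)
      rw [sub_mulVec, dotProduct_sub, trace_sub] at hdiam
      have hopt := hmin k hk (by omega) _ hHK hHpos
      have hprev := ih (by omega)
      rw [hM, minner_add_left, minner_vecMulVec_self, Finset.sum_Icc_succ_top (by omega)]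
      linarith
  obtain ⟨-, -, -, -, hHmem, hHpos, -⟩ := hstep T hT le_rfl
  have hlin : ∑ t ∈ Finset.Icc 1 T, L t (x t) - ∑ t ∈ Finset.Icc 1 T, L t y ≤
      ∑ t ∈ Finset.Icc 1 T, g t ⬝ᵥ (x t - y) := by
    rw [← Finset.sum_sub_distrib]
    refine Finset.sum_le_sum fun t ht => ?_
    obtain ⟨ht₁, htT⟩ := Finset.mem_Icc.mp ht
    obtain ⟨hdiff, hconv, hg, -⟩ := hstep t ht₁ htT
    rw [hg]
    exact hconv.sub_le_grad_dotProduct hdiff _ _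
  have hbal := mul_trace_le_minner_inv_of_isMinimizer K ((hK _).mp hHmem).1 hHpos
    (hmin T hT le_rfl)
  have hval := isMinimizer_le_adaNorm K hK hε hη T g (hMsum T le_rfl ▸ hmin T hT le_rfl)
  rw [← hMsum T le_rfl] at hval
  have hfin := hregret T hT le_rfl
  have hlast := hHpos.posSemidef.dotProduct_mulVec_self_nonneg (x (T + 1) - y)
  have hconst : 2 * Real.sqrt 2 * norm𝒳 = 2 * η := mul_assoc _ _ _
  have hfour : 4 * norm𝒳 ^ 2 = 2 * η ^ 2 := by rw [hηsq]; ring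
  rw [hfour, mul_assoc] at hfin
  rw [hconst]
  linarith
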